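/- Let p be a prime, m a positive integer with p > 3m², and d an integer with 2 ≤ d ≤ m. Then the number of pairs (a, b) ∈ [p]² such that h_{a,b} maps all elements of {0, 1, ..., d−1} to a single value is at least p²/(6·d·m). -/

import Mathlib

/-- The simple linear hash function `h_{a,b}(x) = ((a·x + b) mod p) mod m`. -/
def hab (p m a b x : ℕ) : ℕ := ((a * x + b) % p) % m

/-- If `a` is a multiple of `m` and `a * x + b` does not wrap around modulo `p` for `x < d`,
then `hab p m a b` is constant on `{0, …, d - 1}`. -/
theorem hab_mul_eq_of_lt {p m d i b x : ℕ} (hb : b + m * (d - 1) * i < p) (hx : x < d) :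
    hab p m (m * i) b x = b % m := by
  have hle : m * i * x ≤ m * (d - 1) * i := by
    calc m * i * x ≤ m * i * (d - 1) := Nat.mul_le_mul_left _ (by omega)
      _ = m * (d - 1) * i := by ring
  rw [hab, Nat.mod_eq_of_lt (show m * i * x + b < p by omega), mul_assoc, Nat.mul_add_mod]

/-- The staircase sum `∑ (p - c * i)` over its nonnegative terms is at least the area
`p ^ 2 / (2 * c)` of the triangle it covers. -/
theorem sq_le_two_mul_sum_sub (p c : ℕ) (hc : 0 < c) :
    (p : ℝ) ^ 2 ≤ 2 * c * ((∑ i ∈ Finset.range (p / c + 1), (p - c * i) : ℕ) : ℝ) := by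
  have hcast : ((∑ i ∈ Finset.range (p / c + 1), (p - c * i) : ℕ) : ℝ) =
      ∑ i ∈ Finset.range (p / c + 1), ((p : ℝ) - c * i) := by
    rw [Nat.cast_sum]
    refine Finset.sum_congr rfl fun i hi => ?_
    have hi' : i ≤ p / c := Nat.lt_succ_iff.mp (Finset.mem_range.mp hi)
    have hle : c * i ≤ p := (Nat.mul_le_mul_left c hi').trans (Nat.mul_div_le p c)
    push_cast [Nat.cast_sub hle]
    ring
  have hsum (k : ℕ) : 2 * ∑ i ∈ Finset.range (k + 1), ((p : ℝ) - c * i) =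
      (k + 1) * (2 * p - c * k) := by
    induction k with
    | zero => simp
    | succ k ih =>
      rw [Finset.sum_range_succ, mul_add, ih]
      push_cast
      ring
  have hdiv : (p : ℝ) = c * (p / c : ℕ) + (p % c : ℕ) := by
    exact_mod_cast (Nat.div_add_mod p c).symm
  have hmod : ((p % c : ℕ) : ℝ) ≤ c := by exact_mod_cast (Nat.mod_lt p hc).le
  have hr : (0 : ℝ) ≤ (p % c : ℕ) := Nat.cast_nonneg _
  have hp : (0 : ℝ) ≤ p := Nat.cast_nonneg _
  rw [hcast, mul_right_comm, hsum]
  generalize ((p / c : ℕ) : ℝ) = k at *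
  generalize ((p % c : ℕ) : ℝ) = r at *
  have key : ((k : ℝ) + 1) * (2 * p - c * k) * c = (p + (c - r)) * (p + r) := by
    rw [show (c : ℝ) * k = p - r by linarith,
      show ((k : ℝ) + 1) * (2 * p - (p - r)) * c = (c * k + c) * (p + r) by ring,
      show (c : ℝ) * k = p - r by linarith]
    ring
  rw [key]
  nlinarith [mul_nonneg (sub_nonneg.mpr hmod) hr, mul_nonneg hp (Nat.cast_nonneg (α := ℝ) c)]

/-- **Counting version of the collision lower bound.**  For a prime `p` and a
positive integer `m` with `p > 3m²`, and an integer `d` with `2 ≤ d ≤ m`, the number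
of pairs `(a, b) ∈ [p]²` such that `h_{a,b}` maps all elements of `{0, 1, …, d−1}`
to a single value is at least `p²/(6·d·m)`. -/
theorem interval_collision_count_lower_bound
    (p m d : ℕ) (hp : p.Prime) (hm : 0 < m) (hpm : 3 * m ^ 2 < p)
    (hd2 : 2 ≤ d) (hdm : d ≤ m) :
    (p : ℝ) ^ 2 / (6 * (d : ℝ) * m) ≤
      ((((Finset.range p) ×ˢ (Finset.range p)).filter (fun ab =>
          ((Finset.range d).image (fun x => hab p m ab.1 ab.2 x)).card = 1)).card : ℝ) := by
  have hc : 0 < m * (d - 1) := Nat.mul_pos hm (by omega)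
  have hcount : ∑ i ∈ Finset.range (p / (m * (d - 1)) + 1), (p - m * (d - 1) * i) ≤
      (((Finset.range p) ×ˢ (Finset.range p)).filter (fun ab =>
        ((Finset.range d).image (fun x => hab p m ab.1 ab.2 x)).card = 1)).card := by
    rw [← Finset.sum_congr rfl fun i _ => Finset.card_range (p - m * (d - 1) * i),
      ← Finset.card_sigma]
    refine Finset.card_le_card_of_injOn (fun q => (m * q.1, q.2)) ?_ ?_
    · rintro ⟨i, b⟩ hq
      have hb : b < p - m * (d - 1) * i := by
        simpa using (Finset.mem_sigma.mp (Finset.mem_coe.mp hq)).2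
      have hle : m * i ≤ m * (d - 1) * i :=
        Nat.mul_le_mul_right i (Nat.le_mul_of_pos_right m (by omega))
      simp only [Finset.coe_filter, Finset.mem_product, Finset.mem_range, Set.mem_ofPred_eq]
      refine ⟨⟨by omega, by omega⟩, Finset.card_eq_one.mpr ⟨b % m, ?_⟩⟩
      rw [Finset.image_congr (g := fun _ => b % m) fun x hx =>
        hab_mul_eq_of_lt (i := i) (Nat.add_lt_of_lt_sub hb) (by simpa using hx)]
      exact Finset.image_const (Finset.nonempty_range_iff.mpr (by omega)) _
    · rintro ⟨i, b⟩ - ⟨j, b'⟩ - h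
      obtain ⟨hij, rfl⟩ := Prod.mk.inj h
      obtain rfl := Nat.eq_of_mul_eq_mul_left hm hij
      rfl
  refine le_trans ?_ (Nat.cast_le.mpr hcount)
  have hm' : (0 : ℝ) < m := by exact_mod_cast hm
  have hd' : (0 : ℝ) < d := by exact_mod_cast (by omega : 0 < d)
  rw [div_le_iff₀' (by positivity)]
  refine (sq_le_two_mul_sum_sub p _ hc).trans (mul_le_mul_of_nonneg_right ?_ (Nat.cast_nonneg _))
  have hcd : ((m * (d - 1) : ℕ) : ℝ) ≤ m * d := by
    exact_mod_cast Nat.mul_le_mul_left m (Nat.sub_le d 1)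
  nlinarith [mul_pos hm' hd']
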